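/- Let K ⊆ ℝⁿ be a convex body with b(K) = 0, and let x ∈ K with gauge ‖x‖_K = inf{s ≥ 0 : x ∈ sK}. Then vol((K−x) ∩ (x−K)) ≥ (1/2)^n (1 − ‖x‖_K)^n vol(K); i.e., K−x is (1/2)(1 − ‖x‖_K)-symmetric. -/

import Mathlib

open Set MeasureTheory
open scoped ENNReal Pointwise

lemma volume_add_volume_le_volume_add_of_isCompact {A B : Set ℝ} (hA : IsCompact A)
    (hB : IsCompact B) (hA' : A.Nonempty) (hB' : B.Nonempty) :
    volume A + volume B ≤ volume (A + B) := by
  obtain ⟨a, haA, ha⟩ := hA.exists_isGreatest hA'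
  obtain ⟨b, hbB, hb⟩ := hB.exists_isLeast hB'
  have hdisj : AEDisjoint volume (b +ᵥ A) (a +ᵥ B) := by
    refine measure_mono_null (t := {a + b}) ?_ (by simp)
    rintro _ ⟨⟨x, hx, rfl⟩, y, hy, hxy⟩
    have := ha hx
    have := hb hy
    simp only [vadd_eq_add, mem_singleton_iff] at *
    linarith
  calc volume A + volume B = volume (b +ᵥ A) + volume (a +ᵥ B) := by
        rw [measure_vadd, measure_vadd]
    _ = volume ((b +ᵥ A) ∪ (a +ᵥ B)) :=
        (measure_union₀ (hB.vadd a).measurableSet.nullMeasurableSet hdisj).symm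
    _ ≤ volume (A + B) := by
        refine measure_mono (union_subset ?_ ?_)
        · rintro _ ⟨x, hx, rfl⟩
          exact ⟨x, hx, b, hbB, add_comm _ _⟩
        · rintro _ ⟨y, hy, rfl⟩
          exact ⟨a, haA, y, hy, rfl⟩

/-- The one-dimensional Brunn–Minkowski inequality. -/
lemma volume_add_volume_le_volume_add {A B : Set ℝ} (hA : MeasurableSet A)
    (hB : MeasurableSet B) (hA' : A.Nonempty) (hB' : B.Nonempty) :
    volume A + volume B ≤ volume (A + B) := by
  obtain ⟨a, ha⟩ := hA'
  obtain ⟨b, hb⟩ := hB'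
  have key : ∀ A' ⊆ A, IsCompact A' → ∀ B' ⊆ B, IsCompact B' →
      volume A' + volume B' ≤ volume (A + B) := by
    intro A' hAA' hA' B' hBB' hB'
    calc volume A' + volume B' ≤ volume (insert a A') + volume (insert b B') := by
          gcongr <;> exact subset_insert _ _
      _ ≤ volume (insert a A' + insert b B') :=
          volume_add_volume_le_volume_add_of_isCompact (hA'.insert a) (hB'.insert b)
            (insert_nonempty _ _) (insert_nonempty _ _)
      _ ≤ volume (A + B) :=
          measure_mono (add_subset_add (insert_subset ha hAA') (insert_subset hb hBB'))
  rw [hA.measure_eq_iSup_isCompact, hB.measure_eq_iSup_isCompact]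
  simp only [iSup_and']
  exact ENNReal.biSup_add_biSup_le' ⟨∅, empty_subset _, isCompact_empty⟩
    ⟨∅, empty_subset _, isCompact_empty⟩ fun A' hA' B' hB' ↦ key A' hA'.1 hA'.2 B' hB'.1 hB'.2

lemma volume_combo_le_of_combo_mem {A B C : Set ℝ} (hA : MeasurableSet A)
    (hB : MeasurableSet B) (hA' : A.Nonempty) (hB' : B.Nonempty) {s t : ℝ} (hs : 0 < s)
    (ht : 0 < t) (h : ∀ x ∈ A, ∀ y ∈ B, s * x + t * y ∈ C) :
    ENNReal.ofReal s * volume A + ENNReal.ofReal t * volume B ≤ volume C := by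
  have := volume_add_volume_le_volume_add (hA.const_smul_of_ne_zero hs.ne')
    (hB.const_smul_of_ne_zero ht.ne') (hA'.smul_set (a := s)) (hB'.smul_set (a := t))
  rw [Measure.addHaar_smul, Measure.addHaar_smul] at this
  simp only [Module.finrank_self, pow_one, abs_of_pos hs, abs_of_pos ht] at this
  refine this.trans (measure_mono ?_)
  rintro _ ⟨_, ⟨x, hx, rfl⟩, _, ⟨y, hy, rfl⟩, rfl⟩
  exact h x hx y hy

/-- Layer-cake formula for a function truncated at `1`. -/
lemma lintegral_min_one_eq_lintegral_meas_lt {α : Type*} [MeasurableSpace α] (μ : Measure α)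
    {f : α → ℝ≥0∞} (hf : Measurable f) :
    ∫⁻ x, min (f x) 1 ∂μ = ∫⁻ t in Ioo (0 : ℝ) 1, μ {x | ENNReal.ofReal t < f x} := by
  have hfin : ∀ x, min (f x) 1 ≠ ∞ := fun x ↦ ((min_le_right _ _).trans_lt ENNReal.one_lt_top).ne
  have h := lintegral_eq_lintegral_meas_lt (f := fun x ↦ (min (f x) 1).toReal) μ
    (Filter.Eventually.of_forall fun x ↦ ENNReal.toReal_nonneg)
    (hf.min measurable_const).ennreal_toReal.aemeasurable
  simp only [ENNReal.ofReal_toReal (hfin _)] at h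
  rw [h, ← Ioo_union_Ici_eq_Ioi (zero_lt_one' ℝ), lintegral_union measurableSet_Ici
    (by rw [Set.disjoint_left]; exact fun x hx hx' ↦ hx.2.not_ge hx')]
  have h0 : ∫⁻ t in Ici (1 : ℝ), μ {x | t < (min (f x) 1).toReal} = 0 := by
    rw [setLIntegral_congr_fun (g := fun _ ↦ 0) measurableSet_Ici]
    · simp
    · intro t ht
      have : {x | t < (min (f x) 1).toReal} = ∅ := by
        ext x
        simp only [mem_ofPred_eq, mem_empty_iff_false, iff_false, not_lt]
        refine le_trans ?_ ht
        simpa using ENNReal.toReal_mono ENNReal.one_ne_top (min_le_right (f x) 1)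
      simp [this]
  rw [h0, add_zero]
  refine setLIntegral_congr_fun measurableSet_Ioo fun t ht ↦ ?_
  congr 1
  ext x
  simp only [mem_ofPred_eq]
  rw [← ENNReal.ofReal_lt_iff_lt_toReal ht.1.le (hfin x), lt_min_iff]
  simp [ht.2]

lemma ENNReal.geom_mean_le_arith_mean2 {s t : ℝ} (hs : 0 < s) (ht : 0 < t) (hst : s + t = 1)
    (a b : ℝ≥0∞) : a ^ s * b ^ t ≤ ENNReal.ofReal s * a + ENNReal.ofReal t * b := by
  rcases eq_or_ne a ∞ with rfl | ha
  · simp [ENNReal.mul_top, hs]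
  rcases eq_or_ne b ∞ with rfl | hb
  · simp [ENNReal.mul_top, ht]
  lift a to NNReal using ha
  lift b to NNReal using hb
  have h := NNReal.geom_mean_le_arith_mean2_weighted s.toNNReal t.toNNReal a b
    (by rw [← Real.toNNReal_add hs.le ht.le, hst, Real.toNNReal_one])
  rw [Real.coe_toNNReal _ hs.le, Real.coe_toNNReal _ ht.le] at h
  rw [← ENNReal.coe_rpow_of_nonneg _ hs.le, ← ENNReal.coe_rpow_of_nonneg _ ht.le]
  rw [ENNReal.ofReal, ENNReal.ofReal]
  exact_mod_cast h

lemma prekopa_leindler_real_of_iSup_ne_top {f g h : ℝ → ℝ≥0∞} (hf : Measurable f)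
    (hg : Measurable g) (hh : Measurable h) {s t : ℝ} (hs : 0 < s) (ht : 0 < t)
    (hst : s + t = 1) (H : ∀ x y, f x ^ s * g y ^ t ≤ h (s * x + t * y))
    (hfb : ⨆ x, f x ≠ ∞) (hgb : ⨆ x, g x ≠ ∞) :
    (∫⁻ x, f x) ^ s * (∫⁻ x, g x) ^ t ≤ ∫⁻ x, h x := by
  set a := ⨆ x, f x with ha
  set b := ⨆ x, g x with hb
  rcases eq_or_ne a 0 with ha0 | ha0
  · have : ∀ x, f x = 0 := by simpa [ha] using ha0
    simp [this, hs]
  rcases eq_or_ne b 0 with hb0 | hb0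
  · have : ∀ x, g x = 0 := by simpa [hb] using hb0
    simp [this, ht]
  set c := a ^ s * b ^ t with hc
  have has0 : a ^ s ≠ 0 := by simp [ha0, hfb]
  have hbt0 : b ^ t ≠ 0 := by simp [hb0, hgb]
  have hasT : a ^ s ≠ ∞ := by simp [ha0, hfb]
  have hbtT : b ^ t ≠ ∞ := by simp [hb0, hgb]
  have hc0 : c ≠ 0 := mul_ne_zero has0 hbt0
  have hcT : c ≠ ∞ := ENNReal.mul_ne_top hasT hbtT
  have hlevel : ∀ r ∈ Ioo (0 : ℝ) 1,
      ENNReal.ofReal s * volume {x | ENNReal.ofReal r < f x / a} +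
        ENNReal.ofReal t * volume {x | ENNReal.ofReal r < g x / b} ≤
      volume {x | ENNReal.ofReal r < h x / c} := by
    intro r hr
    have hr1 : ENNReal.ofReal r < 1 := by simpa using hr.2
    have hne : ∀ (u : ℝ → ℝ≥0∞) (d : ℝ≥0∞), d = ⨆ x, u x → d ≠ 0 → d ≠ ∞ →
        {x | ENNReal.ofReal r < u x / d}.Nonempty := by
      intro u d hd hd0 hdT
      have : ENNReal.ofReal r * d < ⨆ x, u x := by
        rw [← hd]
        simpa using (ENNReal.mul_lt_mul_iff_left hd0 hdT).2 hr1
      obtain ⟨x, hx⟩ := lt_iSup_iff.1 this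
      exact ⟨x, (ENNReal.lt_div_iff_mul_lt (Or.inl hd0) (Or.inl hdT)).2 hx⟩
    refine volume_combo_le_of_combo_mem (measurableSet_lt measurable_const (hf.div_const a))
      (measurableSet_lt measurable_const (hg.div_const b)) (hne f a ha ha0 hfb)
      (hne g b hb hb0 hgb) hs ht fun x hx y hy ↦ ?_
    simp only [mem_ofPred_eq] at hx hy ⊢
    have hr0 : ENNReal.ofReal r ≠ 0 := by simpa using hr.1
    calc ENNReal.ofReal r = ENNReal.ofReal r ^ s * ENNReal.ofReal r ^ t := by
          rw [← ENNReal.rpow_add _ _ hr0 ENNReal.ofReal_ne_top, hst, ENNReal.rpow_one]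
      _ < (f x / a) ^ s * (g y / b) ^ t :=
          ENNReal.mul_lt_mul (ENNReal.rpow_lt_rpow hx hs) (ENNReal.rpow_lt_rpow hy ht)
      _ = f x ^ s * g y ^ t / c := by
          rw [ENNReal.div_rpow_of_nonneg _ _ hs.le, ENNReal.div_rpow_of_nonneg _ _ ht.le, hc,
            div_eq_mul_inv, div_eq_mul_inv, div_eq_mul_inv,
            ENNReal.mul_inv (Or.inl has0) (Or.inl hasT)]
          ring
      _ ≤ h (s * x + t * y) / c := by gcongr; exact H x y
  have hmeas : ∀ (u : ℝ → ℝ≥0∞),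
      Measurable fun r : ℝ ↦ volume {x | ENNReal.ofReal r < u x} := by
    intro u
    refine Antitone.measurable fun r₁ r₂ hr ↦ measure_mono fun x hx ↦ ?_
    exact (ENNReal.ofReal_le_ofReal hr).trans_lt hx
  have hsum : ENNReal.ofReal s * (∫⁻ x, f x / a) + ENNReal.ofReal t * (∫⁻ x, g x / b) ≤
      ∫⁻ x, h x / c := by
    have hf1 : ∀ x, min (f x / a) 1 = f x / a := fun x ↦
      min_eq_left (ENNReal.div_le_of_le_mul (by simpa using le_iSup f x))
    have hg1 : ∀ x, min (g x / b) 1 = g x / b := fun x ↦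
      min_eq_left (ENNReal.div_le_of_le_mul (by simpa using le_iSup g x))
    have e1 := lintegral_min_one_eq_lintegral_meas_lt volume (hf.div_const a)
    have e2 := lintegral_min_one_eq_lintegral_meas_lt volume (hg.div_const b)
    have e3 := lintegral_min_one_eq_lintegral_meas_lt volume (hh.div_const c)
    simp only [hf1] at e1
    simp only [hg1] at e2
    calc _ ≤ ∫⁻ x, min (h x / c) 1 := by
          rw [e1, e2, e3, ← lintegral_const_mul _ (hmeas _), ← lintegral_const_mul _ (hmeas _),
            ← lintegral_add_left ((hmeas _).const_mul _)]
          exact setLIntegral_mono' measurableSet_Ioo hlevel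
      _ ≤ ∫⁻ x, h x / c := lintegral_mono fun x ↦ min_le_left _ _
  have hgm := (ENNReal.geom_mean_le_arith_mean2 hs ht hst _ _).trans hsum
  simp only [div_eq_mul_inv] at hgm
  rw [lintegral_mul_const _ hf, lintegral_mul_const _ hg, lintegral_mul_const _ hh,
    ← div_eq_mul_inv, ← div_eq_mul_inv, ← div_eq_mul_inv,
    ENNReal.div_rpow_of_nonneg _ _ hs.le, ENNReal.div_rpow_of_nonneg _ _ ht.le,
    ENNReal.le_div_iff_mul_le (Or.inl hc0) (Or.inl hcT)] at hgm
  convert hgm using 1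
  rw [hc]
  calc _ = ((∫⁻ x, f x) ^ s / a ^ s * a ^ s) * ((∫⁻ x, g x) ^ t / b ^ t * b ^ t) := by
        rw [ENNReal.div_mul_cancel has0 hasT, ENNReal.div_mul_cancel hbt0 hbtT]
    _ = _ := by ring

/-- The one-dimensional Prékopa–Leindler inequality. -/
lemma prekopa_leindler_real {f g h : ℝ → ℝ≥0∞} (hf : Measurable f)
    (hg : Measurable g) (hh : Measurable h) {s t : ℝ} (hs : 0 < s) (ht : 0 < t)
    (hst : s + t = 1) (H : ∀ x y, f x ^ s * g y ^ t ≤ h (s * x + t * y)) :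
    (∫⁻ x, f x) ^ s * (∫⁻ x, g x) ^ t ≤ ∫⁻ x, h x := by
  rcases eq_or_ne (∫⁻ x, f x) 0 with hf0 | hf0
  · simp [hf0, hs]
  rcases eq_or_ne (∫⁻ x, g x) 0 with hg0 | hg0
  · simp [hg0, ht]
  have hlim : ∀ {u : ℝ → ℝ≥0∞}, Measurable u →
      Filter.Tendsto (fun n : ℕ ↦ ∫⁻ x, min (u x) n) Filter.atTop (nhds (∫⁻ x, u x)) := by
    intro u hu
    refine lintegral_tendsto_of_tendsto_of_monotone
      (fun n ↦ (hu.min measurable_const).aemeasurable) ?_ ?_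
    · exact Filter.Eventually.of_forall fun x m n hmn ↦ by dsimp only; gcongr
    · refine Filter.Eventually.of_forall fun x ↦ ?_
      simpa using (tendsto_const_nhds (x := u x)).min ENNReal.tendsto_nat_nhds_top
  have hlim' := ENNReal.Tendsto.mul ((hlim hf).ennrpow_const s)
    (Or.inl (by simp [hf0, hs, hs.le])) ((hlim hg).ennrpow_const t)
    (Or.inl (by simp [hg0, ht, ht.le]))
  refine le_of_tendsto' hlim' fun n ↦ ?_
  have hbdd : ∀ u : ℝ → ℝ≥0∞, ⨆ x, min (u x) (n : ℝ≥0∞) ≠ ∞ := fun u ↦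
    ((iSup_le fun x ↦ min_le_right _ _).trans_lt (ENNReal.natCast_lt_top n)).ne
  refine prekopa_leindler_real_of_iSup_ne_top (hf.min measurable_const)
    (hg.min measurable_const) hh hs ht hst (fun x y ↦ le_trans ?_ (H x y)) (hbdd f) (hbdd g)
  gcongr <;> exact min_le_left _ _

/-- The **Prékopa–Leindler inequality** in `Fin n → ℝ`. -/
theorem prekopa_leindler {n : ℕ} {f g h : (Fin n → ℝ) → ℝ≥0∞} (hf : Measurable f)
    (hg : Measurable g) (hh : Measurable h) {s t : ℝ} (hs : 0 < s) (ht : 0 < t)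
    (hst : s + t = 1) (H : ∀ x y, f x ^ s * g y ^ t ≤ h (s • x + t • y)) :
    (∫⁻ x, f x) ^ s * (∫⁻ x, g x) ^ t ≤ ∫⁻ x, h x := by
  induction n with
  | zero =>
    have hv : (volume : Measure (Fin 0 → ℝ)) = Measure.dirac default := by
      rw [volume_pi, Measure.pi_of_empty _ default]
    rw [hv, lintegral_dirac, lintegral_dirac, lintegral_dirac]
    convert H default default using 2
  | succ n ih =>
    set e := (MeasurableEquiv.piFinSuccAbove (fun _ : Fin (n + 1) ↦ ℝ) 0).symm with he
    have hint : ∀ u : (Fin (n + 1) → ℝ) → ℝ≥0∞, Measurable u →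
        ∫⁻ x, u x = ∫⁻ a, ∫⁻ y, u (e (a, y)) := by
      intro u hu
      rw [← ((volume_preserving_piFinSuccAbove (fun _ : Fin (n + 1) ↦ ℝ) 0).symm).lintegral_comp
        hu]
      exact lintegral_prod _ (hu.comp e.measurable).aemeasurable
    have hsec : ∀ {u : (Fin (n + 1) → ℝ) → ℝ≥0∞}, Measurable u →
        Measurable fun p : ℝ × (Fin n → ℝ) ↦ u (e p) := fun hu ↦ hu.comp e.measurable
    have hcombo : ∀ (a b : ℝ) (x y : Fin n → ℝ),
        e (s * a + t * b, s • x + t • y) = s • e (a, x) + t • e (b, y) := by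
      intro a b x y
      ext i
      refine Fin.cases ?_ (fun j ↦ ?_) i <;> simp [he, MeasurableEquiv.piFinSuccAbove]
    rw [hint f hf, hint g hg, hint h hh]
    refine prekopa_leindler_real (hsec hf).lintegral_prod_right' (hsec hg).lintegral_prod_right'
      (hsec hh).lintegral_prod_right' hs ht hst fun a b ↦ ?_
    refine ih ((hsec hf).comp measurable_prodMk_left) ((hsec hg).comp measurable_prodMk_left)
      ((hsec hh).comp measurable_prodMk_left) fun x y ↦ ?_
    simpa only [← hcombo] using H (e (a, x)) (e (b, y))

lemma ConcaveOn.exists_supergradient {E : Type*} [NormedAddCommGroup E] [NormedSpace ℝ E]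
    [FiniteDimensional ℝ E] {S : Set E} {φ : E → ℝ} (hφ : ConcaveOn ℝ S φ)
    (h0 : (0 : E) ∈ interior S) : ∃ l : E →L[ℝ] ℝ, ∀ y ∈ S, φ y ≤ φ 0 + l y := by
  have hφ' : ConcaveOn ℝ (interior S) φ := hφ.subset interior_subset hφ.1.interior
  have hopen : IsOpen {p : E × ℝ | p.1 ∈ interior S ∧ p.2 < φ p.1} := by
    rw [isOpen_iff_mem_nhds]
    rintro ⟨y, r⟩ ⟨hy, hr⟩
    have hc : ContinuousAt φ y :=
      hφ.continuousOn_interior.continuousAt (isOpen_interior.mem_nhds hy)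
    have h1 : ∀ᶠ p : E × ℝ in nhds (y, r), p.1 ∈ interior S :=
      continuous_fst.continuousAt.eventually (isOpen_interior.mem_nhds hy)
    have h2 : ∀ᶠ p : E × ℝ in nhds (y, r), p.2 < φ p.1 :=
      continuous_snd.continuousAt.eventually_lt
        (ContinuousAt.comp (f := Prod.fst) (x := (y, r)) hc continuous_fst.continuousAt) hr
    exact h1.and h2
  obtain ⟨F, hF⟩ := geometric_hahn_banach_open_point (x := ((0 : E), φ 0))
    hφ'.convex_strict_hypograph hopen (fun h ↦ lt_irrefl _ h.2)
  have hsplit : ∀ (y : E) (r : ℝ), F (y, r) = F (y, 0) + r * F (0, 1) := by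
    intro y r
    have : ((y, r) : E × ℝ) = (y, 0) + r • (0, 1) := by simp
    rw [this, map_add, map_smul, smul_eq_mul]
  set c := F (0, 1) with hc
  have hF0 : F ((0 : E), (0 : ℝ)) = 0 := map_zero F
  have hcpos : 0 < c := by
    have h := hF (0, φ 0 - 1) ⟨h0, by simp⟩
    rw [hsplit, hsplit 0 (φ 0)] at h
    linarith
  refine ⟨-(c⁻¹ • F.comp (ContinuousLinearMap.inl ℝ E ℝ)), ?_⟩
  have hint : ∀ y ∈ interior S, c * φ y ≤ c * φ 0 - F (y, 0) := by
    intro y hy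
    refine le_of_forall_pos_lt_add fun ε hε ↦ ?_
    have h := hF (y, φ y - ε / c) ⟨hy, by simpa using div_pos hε hcpos⟩
    rw [hsplit, hsplit 0 (φ 0), hF0] at h
    have : ε / c * c = ε := div_mul_cancel₀ _ hcpos.ne'
    linarith
  intro y hy
  have hy2 : (1 / 2 : ℝ) • (0 : E) + (1 / 2 : ℝ) • y ∈ interior S :=
    hφ.1.combo_interior_self_mem_interior h0 hy (by norm_num) (by norm_num) (by norm_num)
  have h1 : (1 / 2 : ℝ) • φ 0 + (1 / 2 : ℝ) • φ y ≤ φ ((1 / 2 : ℝ) • 0 + (1 / 2 : ℝ) • y) :=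
    hφ.2 (interior_subset h0) hy (by norm_num) (by norm_num) (by norm_num)
  have h2 := hint _ hy2
  rw [smul_zero, zero_add] at h1 h2
  have h3 : F ((1 / 2 : ℝ) • y, 0) = 1 / 2 * F (y, 0) := by
    have : (((1 / 2 : ℝ) • y, 0) : E × ℝ) = (1 / 2 : ℝ) • (y, 0) := by simp
    rw [this, map_smul, smul_eq_mul]
  have h4 := mul_le_mul_of_nonneg_left h1 hcpos.le
  simp only [smul_eq_mul] at h4
  have h5 : c * φ y ≤ c * φ 0 - F (y, 0) := by linarith
  have h6 : φ y ≤ c⁻¹ * (c * φ 0 - F (y, 0)) := (le_inv_mul_iff₀ hcpos).2 h5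
  rw [mul_sub, inv_mul_cancel_left₀ hcpos.ne'] at h6
  simpa [sub_eq_add_neg] using h6

/-- The volume of `K ∩ (y - K)`, as a function of `y`, is log-concave. -/
lemma volume_inter_sub_rpow_mul_le {n : ℕ} {K : Set (Fin n → ℝ)} (hconv : Convex ℝ K)
    (hcomp : IsCompact K) {s t : ℝ} (hs : 0 < s) (ht : 0 < t) (hst : s + t = 1)
    (y z : Fin n → ℝ) :
    volume {a | a ∈ K ∧ y - a ∈ K} ^ s * volume {a | a ∈ K ∧ z - a ∈ K} ^ t ≤
      volume {a | a ∈ K ∧ s • y + t • z - a ∈ K} := by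
  have hm : ∀ w : Fin n → ℝ, MeasurableSet {a | a ∈ K ∧ w - a ∈ K} := fun w ↦
    hcomp.measurableSet.inter (measurable_const.sub measurable_id hcomp.measurableSet)
  have key := prekopa_leindler (f := {a | a ∈ K ∧ y - a ∈ K}.indicator 1)
    (g := {a | a ∈ K ∧ z - a ∈ K}.indicator 1)
    (h := {a | a ∈ K ∧ s • y + t • z - a ∈ K}.indicator 1)
    (measurable_one.indicator (hm _)) (measurable_one.indicator (hm _))
    (measurable_one.indicator (hm _)) hs ht hst ?_
  · simpa only [lintegral_indicator_one (hm _)] using key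
  · intro a b
    by_cases ha : a ∈ {a | a ∈ K ∧ y - a ∈ K}
    · by_cases hb : b ∈ {a | a ∈ K ∧ z - a ∈ K}
      · have : s • a + t • b ∈ {a | a ∈ K ∧ s • y + t • z - a ∈ K} := by
          refine ⟨hconv ha.1 hb.1 hs.le ht.le hst, ?_⟩
          convert hconv ha.2 hb.2 hs.le ht.le hst using 1
          module
        rw [indicator_of_mem ha, indicator_of_mem hb, indicator_of_mem this]
        simp
      · rw [indicator_of_notMem hb]
        simp [ht]
    · rw [indicator_of_notMem ha]
      simp [hs]

lemma exists_volume_inter_sub_le_exp {n : ℕ} {K : Set (Fin n → ℝ)} (hconv : Convex ℝ K)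
    (hcomp : IsCompact K) (hint : 0 ∈ interior K) :
    0 < volume.real {a | a ∈ K ∧ 0 - a ∈ K} ∧
    ∃ l : (Fin n → ℝ) →L[ℝ] ℝ, ∀ y, volume.real {a | a ∈ K ∧ y - a ∈ K} ≤
      volume.real {a | a ∈ K ∧ 0 - a ∈ K} * Real.exp (l y) := by
  set f : (Fin n → ℝ) → ℝ := fun y ↦ volume.real {a | a ∈ K ∧ y - a ∈ K} with hf
  have hfnn : ∀ y, 0 ≤ f y := fun y ↦ measureReal_nonneg
  have hfin : ∀ y, volume {a | a ∈ K ∧ y - a ∈ K} ≠ ∞ := fun y ↦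
    ((measure_mono fun a ha ↦ ha.1).trans_lt hcomp.measure_lt_top).ne
  have hlc : ∀ {s t : ℝ}, 0 < s → 0 < t → s + t = 1 → ∀ y z,
      f y ^ s * f z ^ t ≤ f (s • y + t • z) := by
    intro s t hs ht hst y z
    have := ENNReal.toReal_mono (hfin _) (volume_inter_sub_rpow_mul_le hconv hcomp hs ht hst y z)
    rwa [ENNReal.toReal_mul, ← ENNReal.toReal_rpow, ← ENNReal.toReal_rpow] at this
  have hφ : ConcaveOn ℝ {y | 0 < f y} fun y ↦ Real.log (f y) := by
    rw [concaveOn_iff_forall_pos]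
    refine ⟨convex_iff_forall_pos.2 fun y hy z hz s t hs ht hst ↦ ?_,
      fun y hy z hz s t hs ht hst ↦ ?_⟩
    · exact (mul_pos (Real.rpow_pos_of_pos hy s) (Real.rpow_pos_of_pos hz t)).trans_le
        (hlc hs ht hst y z)
    · have hy' := Real.rpow_pos_of_pos hy s
      have hz' := Real.rpow_pos_of_pos hz t
      have := Real.log_le_log (mul_pos hy' hz') (hlc hs ht hst y z)
      rwa [Real.log_mul hy'.ne' hz'.ne', Real.log_rpow hy, Real.log_rpow hz] at this
  have h0 : (0 : Fin n → ℝ) ∈ interior {y | 0 < f y} := by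
    rw [mem_interior_iff_mem_nhds] at hint ⊢
    have hsub : Filter.Tendsto (fun p : (Fin n → ℝ) × (Fin n → ℝ) ↦ p.1 - p.2)
        (nhds 0 ×ˢ nhds 0) (nhds 0) := by
      simpa using (Filter.tendsto_fst (f := nhds (0 : Fin n → ℝ)) (g := nhds 0)).sub
        Filter.tendsto_snd
    obtain ⟨U, hU, V, hV, hUV⟩ := Filter.mem_prod_iff.1 (hsub hint)
    filter_upwards [hU] with y hy
    refine ENNReal.toReal_pos (ne_of_gt ?_) (hfin y)
    refine (Measure.measure_pos_of_mem_nhds volume (Filter.inter_mem hint hV)).trans_le (measure_mono ?_)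
    exact fun a ha ↦ ⟨ha.1, hUV (mk_mem_prod hy ha.2)⟩
  have hf0 : (0 : Fin n → ℝ) ∈ {y | 0 < f y} := interior_subset h0
  rw [mem_ofPred] at hf0
  obtain ⟨l, hl⟩ := hφ.exists_supergradient h0
  refine ⟨hf0, l, fun y ↦ ?_⟩
  change f y ≤ f 0 * _
  rcases (hfnn y).eq_or_lt with h | h
  · rw [← h]
    positivity
  · rw [← Real.log_le_log_iff h (by positivity), Real.log_mul hf0.ne' (Real.exp_ne_zero _),
      Real.log_exp]
    exact hl y h

/-- The **Milman–Pajor inequality**: a convex body with barycenter `0` satisfies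
`vol K ≤ 2ⁿ vol (K ∩ -K)`. -/
theorem milman_pajor {n : ℕ} {K : Set (Fin n → ℝ)} (hconv : Convex ℝ K) (hcomp : IsCompact K)
    (hint : 0 ∈ interior K) (hbary : ∫ y in K, y = 0) :
    volume.real K ≤ 2 ^ n * volume.real {a | a ∈ K ∧ 0 - a ∈ K} := by
  obtain ⟨hf0, l, hl⟩ := exists_volume_inter_sub_le_exp hconv hcomp hint
  set f : (Fin n → ℝ) → ℝ := fun y ↦ volume.real {a | a ∈ K ∧ y - a ∈ K} with hf
  change 0 < f 0 at hf0
  change ∀ y, f y ≤ f 0 * _ at hl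
  change _ ≤ 2 ^ n * f 0
  have hfnn : ∀ y, 0 ≤ f y := fun y ↦ measureReal_nonneg
  have hKm := hcomp.measurableSet
  set k : (Fin n → ℝ) → ℝ := K.indicator 1 with hk
  set kl : (Fin n → ℝ) → ℝ := K.indicator l with hkl
  have hki : Integrable k := by
    rw [hk, integrable_indicator_iff hKm]
    exact (continuous_one.continuousOn).integrableOn_compact hcomp
  have hkli : Integrable kl := by
    rw [hkl, integrable_indicator_iff hKm]
    exact l.continuous.continuousOn.integrableOn_compact hcomp
  have hkint : ∫ y, k y = volume.real K := integral_indicator_one hKm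
  have hklint : ∫ y, kl y = 0 := by
    rw [hkl, integral_indicator hKm, l.integral_comp_comm, hbary, map_zero]
    exact continuous_id.continuousOn.integrableOn_compact hcomp
  set L := ContinuousLinearMap.mul ℝ ℝ with hL
  have hconvf : convolution k k L volume = f := by
    ext y
    have hm : MeasurableSet {a | a ∈ K ∧ y - a ∈ K} :=
      hKm.inter (measurable_const.sub measurable_id hKm)
    rw [convolution_def, hf]
    dsimp only
    rw [← integral_indicator_one hm]
    congr 1 with a
    by_cases h1 : a ∈ K <;> by_cases h2 : y - a ∈ K <;> simp [hL, hk, indicator, h1, h2]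
  have hfi : Integrable f := hconvf ▸ hki.integrable_convolution L hki
  have hfint : ∫ y, f y = volume.real K * volume.real K := by
    rw [← hconvf, integral_convolution L hki hki, hkint]
    rfl
  have hc1 := hkli.integrable_convolution L hki
  have hc2 := hki.integrable_convolution L hkli
  have hlf : (fun y ↦ l y * f y) =ᵐ[volume]
      fun y ↦ convolution kl k L volume y + convolution k kl L volume y := by
    filter_upwards [hkli.ae_convolution_exists L hki, hki.ae_convolution_exists L hkli]
      with y h1 h2
    rw [convolution_def, convolution_def, ← integral_add h1 h2, ← hconvf, convolution_def,
      ← integral_const_mul]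
    congr 1 with a
    by_cases h1 : a ∈ K <;> by_cases h2 : y - a ∈ K <;>
      simp [hL, hk, hkl, h1, h2]
  have hlfi : Integrable fun y ↦ l y * f y := (integrable_congr hlf).2 (hc1.add hc2)
  have hlfint : ∫ y, l y * f y = 0 := by
    rw [integral_congr_ae hlf, integral_add hc1 hc2, integral_convolution L hkli hki,
      integral_convolution L hki hkli, hklint]
    simp
  have h2K : IsCompact ((2 : ℝ) • K) := hcomp.smul 2
  have h2Ki : Integrable (((2 : ℝ) • K).indicator (1 : (Fin n → ℝ) → ℝ)) := by
    rw [integrable_indicator_iff h2K.measurableSet]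
    exact (continuous_one.continuousOn).integrableOn_compact h2K
  have hpt : ∀ y, f y ≤ f 0 * ((2 : ℝ) • K).indicator 1 y + l y * f y := by
    intro y
    rcases (hfnn y).eq_or_lt with h | h
    · rw [← h, mul_zero, add_zero]
      exact mul_nonneg hf0.le (indicator_nonneg (fun _ _ ↦ zero_le_one) _)
    · have hy : y ∈ (2 : ℝ) • K := by
        obtain ⟨a, ha, hya⟩ : {a | a ∈ K ∧ y - a ∈ K}.Nonempty := by
          by_contra hne
          rw [not_nonempty_iff_eq_empty] at hne
          simp [hf, hne] at h
        refine ⟨(1 / 2 : ℝ) • a + (1 / 2 : ℝ) • (y - a),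
          hconv ha hya (by norm_num) (by norm_num) (by norm_num), ?_⟩
        simp only
        module
      rw [indicator_of_mem hy, Pi.one_apply, mul_one]
      have h1 : Real.log (f y) ≤ Real.log (f 0) + l y := by
        have := Real.log_le_log h (hl y)
        rwa [Real.log_mul hf0.ne' (Real.exp_ne_zero _), Real.log_exp] at this
      have h2 := Real.log_le_sub_one_of_pos (div_pos hf0 h)
      rw [Real.log_div hf0.ne' h.ne'] at h2
      have h3 : 1 - l y ≤ f 0 / f y := by linarith
      rw [le_div_iff₀ h] at h3
      linarith
  have hvol : volume.real ((2 : ℝ) • K) = 2 ^ n * volume.real K := by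
    rw [measureReal_def, Measure.addHaar_smul, ENNReal.toReal_mul, measureReal_def]
    simp
  have hle := integral_mono hfi ((h2Ki.const_mul (f 0)).add hlfi) hpt
  simp only [Pi.add_apply] at hle
  rw [integral_add (h2Ki.const_mul (f 0)) hlfi, integral_const_mul,
    integral_indicator_one h2K.measurableSet, hlfint, hfint, hvol, add_zero] at hle
  have hKpos : 0 < volume.real K := hf0.trans_le
    (measureReal_mono (fun a ha ↦ ha.1) hcomp.measure_lt_top.ne)
  refine le_of_mul_le_mul_right ?_ hKpos
  linarith

/-- Stability of near-symmetry: if `b(K) = 0` and `x ∈ K`, then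
`vol((K−x) ∩ (x−K)) ≥ (1/2)ⁿ (1 − ‖x‖_K)ⁿ vol(K)`, i.e. `K − x` is
`(1/2)(1 − ‖x‖_K)`-symmetric. -/
theorem sym_stable (n : ℕ) (K : Set (Fin n → ℝ))
    (hconv : Convex ℝ K) (hcomp : IsCompact K) (hint : 0 ∈ interior K)
    (hbary : ∫ y in K, y ∂volume = 0) (x : Fin n → ℝ) (hx : x ∈ K) :
    ENNReal.ofReal ((1 / 2) ^ n * (1 - gauge K x) ^ n) * volume K ≤
      volume (((· - x) '' K) ∩ ((x - ·) '' K)) := by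
  have hg1 : gauge K x ≤ 1 := gauge_le_one_of_mem hx
  have hK0 : K ∈ nhds (0 : Fin n → ℝ) := mem_interior_iff_mem_nhds.1 hint
  have habs : Absorbent ℝ K := absorbent_nhds_zero hK0
  set r := 1 - gauge K x with hr
  have hr0 : 0 ≤ r := by linarith
  have hmem : ∀ z ∈ K, x + r • z ∈ K := by
    intro z hz
    rw [← hcomp.isClosed.closure_eq]
    refine mem_closure_of_gauge_le_one hconv (interior_subset hint) habs ?_
    calc gauge K (x + r • z) ≤ gauge K x + gauge K (r • z) := gauge_add_le hconv habs _ _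
      _ = gauge K x + r * gauge K z := by rw [gauge_smul_of_nonneg hr0, smul_eq_mul]
      _ ≤ gauge K x + r * 1 := by gcongr; exact gauge_le_one_of_mem hz
      _ = 1 := by rw [hr]; ring
  have hsub : r • {a | a ∈ K ∧ 0 - a ∈ K} ⊆ ((· - x) '' K) ∩ ((x - ·) '' K) := by
    rintro _ ⟨z, ⟨hz, hz'⟩, rfl⟩
    refine ⟨⟨x + r • z, hmem z hz, by simp⟩, ⟨x + r • (0 - z), hmem _ hz', by simp⟩⟩
  refine le_trans ?_ (measure_mono hsub)
  have hfin : volume {a | a ∈ K ∧ 0 - a ∈ K} ≠ ∞ :=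
    ((measure_mono fun a ha ↦ ha.1).trans_lt hcomp.measure_lt_top).ne
  rw [Measure.addHaar_smul, Module.finrank_fin_fun, abs_of_nonneg (pow_nonneg hr0 n),
    ← ofReal_measureReal hcomp.measure_lt_top.ne, ← ofReal_measureReal hfin,
    ← ENNReal.ofReal_mul (by positivity), ← ENNReal.ofReal_mul (by positivity)]
  refine ENNReal.ofReal_le_ofReal ?_
  calc (1 / 2) ^ n * r ^ n * volume.real K
      ≤ (1 / 2) ^ n * r ^ n * (2 ^ n * volume.real {a | a ∈ K ∧ 0 - a ∈ K}) := by
        gcongr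
        exact milman_pajor hconv hcomp hint hbary
    _ = ((1 / 2) * 2) ^ n * (r ^ n * volume.real {a | a ∈ K ∧ 0 - a ∈ K}) := by
        rw [mul_pow]; ring
    _ = r ^ n * volume.real {a | a ∈ K ∧ 0 - a ∈ K} := by norm_num
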